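/- arXiv:2104.04745 — 5 statements merged into one kernel-verified Lean document; each statement's English description precedes it below -/
import Mathlib

section
/- For every nonzero complex number λ, there do not exist matrices C : Matrix (Fin 4) (Fin 2) ℂ and F : Matrix (Fin 2) (Fin 4) ℂ such that C * F = λ • T, where T is the 4×4 noisy-typewriter matrix [[1,1,0,0],[0,1,1,0],[0,0,1,1],[1,0,0,1]] regarded as a complex matrix. (The minimum channel dimension needed for the quantum distribution of the typewriter correlation is the rank of T, namely 3.) -/
open Matrix

/-- The product of a `3 × 2` matrix and a `2 × 3` matrix is singular. -/
lemma det_mul_fin_three_fin_two_eq_zero {R : Type*} [CommRing R]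
    (A : Matrix (Fin 3) (Fin 2) R) (B : Matrix (Fin 2) (Fin 3) R) : (A * B).det = 0 := by
  simp only [det_fin_three, mul_apply, Fin.sum_univ_two]
  ring

/-- For every nonzero `λ : ℂ`, no factorization of `λ • T` through inner
dimension 2 exists, `T` being the noisy-typewriter matrix: its rank 3 is the
minimum channel dimension for the quantum distribution of the typewriter
correlation. -/
theorem noisy_typewriter_no_rank_two_factorization (lam : ℂ) (hlam : lam ≠ 0) :
    ¬ ∃ (C : Matrix (Fin 4) (Fin 2) ℂ) (F : Matrix (Fin 2) (Fin 4) ℂ),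
      C * F =
        lam • (!![1, 1, 0, 0; 0, 1, 1, 0; 0, 0, 1, 1; 1, 0, 0, 1] :
          Matrix (Fin 4) (Fin 4) ℂ) := by
  rintro ⟨C, F, h⟩
  have hdet := det_mul_fin_three_fin_two_eq_zero
    (C.submatrix Fin.castSucc id) (F.submatrix id Fin.castSucc)
  rw [← submatrix_mul C F Fin.castSucc id Fin.castSucc Function.bijective_id, h] at hdet
  simp [det_fin_three, hlam] at hdet
end

section
/- If C : Matrix (Fin 4) (Fin 3) ℝ and F : Matrix (Fin 3) (Fin 4) ℝ satisfy C * F = T, where T is the 4×4 noisy-typewriter matrix [[1,1,0,0],[0,1,1,0],[0,0,1,1],[1,0,0,1]], then the first three rows of C are linearly independent in ℝ³ (hence form a basis of ℝ³). -/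
open Matrix

/-- In any factorization `C * F = T` of the noisy-typewriter matrix through
inner dimension 3, the first three rows of `C` are linearly independent
(hence form a basis of `ℝ³`). -/
theorem noisy_typewriter_factorization_rows_linearIndependent
    (C : Matrix (Fin 4) (Fin 3) ℝ) (F : Matrix (Fin 3) (Fin 4) ℝ)
    (h : C * F =
      (!![1, 1, 0, 0; 0, 1, 1, 0; 0, 0, 1, 1; 1, 0, 0, 1] :
        Matrix (Fin 4) (Fin 4) ℝ)) :
    LinearIndependent ℝ (fun i : Fin 3 => C i.castSucc) := by
  rw [Fintype.linearIndependent_iff]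
  intro g hg
  have key (j : Fin 4) : ∑ i : Fin 3, g i * (C * F) i.castSucc j = 0 := by
    have hj := congrFun (congrArg (fun v => v ᵥ* F) hg) j
    simpa [Matrix.sum_vecMul, Matrix.smul_vecMul, Matrix.mul_apply_eq_vecMul] using hj
  rw [h] at key
  have h0 := key 0
  have h1 := key 1
  have h2 := key 2
  simp [Fin.sum_univ_three] at h0 h1 h2
  intro i
  fin_cases i <;> simp <;> linarith
end

section
/- If C : Matrix (Fin 4) (Fin 3) ℝ and F : Matrix (Fin 3) (Fin 4) ℝ satisfy C * F = T, where T is the 4×4 noisy-typewriter matrix [[1,1,0,0],[0,1,1,0],[0,0,1,1],[1,0,0,1]], then the fourth row of C equals (first row of C) − (second row of C) + (third row of C); in particular the coefficient of the second row in this unique expansion is negative. -/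
open Matrix

/-- If `A * B * V = 1` for square matrices over a commutative ring, then `B` acts injectively
on row vectors. -/
lemma eq_zero_of_vecMul_eq_zero_of_mul_mul_eq_one {n R : Type*} [Fintype n] [DecidableEq n]
    [CommRing R] {A B V : Matrix n n R} (hABV : A * B * V = 1) {d : n → R}
    (hd : d ᵥ* B = 0) : d = 0 := by
  have hBVA : B * V * A = 1 := by
    rw [Matrix.mul_assoc] at hABV
    exact mul_eq_one_comm.mp hABV
  calc d = d ᵥ* (B * V * A) := by rw [hBVA, Matrix.vecMul_one]
    _ = 0 := by
      rw [← Matrix.vecMul_vecMul, ← Matrix.vecMul_vecMul, hd, Matrix.zero_vecMul,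
        Matrix.zero_vecMul]

/-- In any factorization `C * F = T` of the noisy-typewriter matrix through
inner dimension 3, the fourth row of `C` equals (first row) − (second row) +
(third row); in particular the coefficient of the second row in this unique
expansion is negative. -/
theorem noisy_typewriter_factorization_fourth_row
    (C : Matrix (Fin 4) (Fin 3) ℝ) (F : Matrix (Fin 3) (Fin 4) ℝ)
    (h : C * F =
      (!![1, 1, 0, 0; 0, 1, 1, 0; 0, 0, 1, 1; 1, 0, 0, 1] :
        Matrix (Fin 4) (Fin 4) ℝ)) :
    C 3 = C 0 - C 1 + C 2 := by
  have hrow (i : Fin 4) : C i ᵥ* F = (C * F) i := rfl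
  have hd : (C 3 - (C 0 - C 1 + C 2)) ᵥ* F = 0 := by
    rw [Matrix.sub_vecMul, Matrix.add_vecMul, Matrix.sub_vecMul, hrow, hrow, hrow, hrow, h]
    ext j
    fin_cases j <;> simp
  have hminor : C.submatrix Fin.castSucc id * F.submatrix id Fin.castSucc *
      !![1, -1, 1; 0, 1, -1; 0, 0, 1] = 1 := by
    rw [← Matrix.submatrix_mul C F _ _ _ Function.bijective_id, h]
    ext i j
    fin_cases i <;> fin_cases j <;> simp [Matrix.mul_apply, Fin.sum_univ_three]
  refine sub_eq_zero.mp (eq_zero_of_vecMul_eq_zero_of_mul_mul_eq_one hminor ?_)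
  ext j
  exact congrFun hd j.castSucc
end

section
/- There exist families of 3×3 complex matrices A, B, C, D : Fin 2 → Matrix (Fin 3) (Fin 3) ℂ such that for all i, j, k, l ∈ Fin 2, trace(A i * B j * C k * D l) = (if i = k then 1 else 0) * (if j = l then 1 else 0). (The crossed distribution of two EPR pairs over a square-shaped quantum network is achievable when the four channels have dimension 3, in contrast with the impossibility for channels of dimension 2.) -/
open Matrix

/-- The crossed distribution of two EPR pairs over a square-shaped quantum
network is achievable when the four channels have dimension 3: a square-network
solution of dimension 3 exists over `ℂ`. -/
theorem square_network_solution_dim_three :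
    ∃ A B C D : Fin 2 → Matrix (Fin 3) (Fin 3) ℂ,
      ∀ i j k l : Fin 2,
        (A i * B j * C k * D l).trace =
          (if i = k then 1 else 0) * (if j = l then 1 else 0) := by
  refine ⟨![1, !![0, 1, 0; 0, 0, 1; 0, 1, 0]],
    ![1, !![0, 0, 0; 0, 0, 0; 1, 0, 0]],
    ![1, !![0, 1, 0; 1, 0, 0; 0, 0, 0]],
    ![!![1, 0, 0; 0, 0, 0; 0, 0, 0], !![-1, 0, 1; 0, 1, 0; 0, 0, 0]], ?_⟩
  intro i j k l
  fin_cases i <;> fin_cases j <;> fin_cases k <;> fin_cases l <;>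
    simp [trace_fin_three]
end

section
/- There exist a real number λ > 0 and families of 3×3 real matrices A, B, C, D : Fin 2 → Matrix (Fin 3) (Fin 3) ℝ with all entries nonnegative such that for all i, j, k, l ∈ Fin 2, trace(A i * B j * C k * D l) = λ * (if i = k then 1 else 0) * (if j = l then 1 else 0). (Crossed distribution of two independent bits over a square classical network is achievable by stochastic classical network coding when the four channels are ternary.) -/
open Matrix

/-- Crossed distribution of two independent bits over a square classical network
is achievable by stochastic classical network coding when the four channels are
ternary: a nonnegative square-network solution of dimension 3 with some positive
scale exists. -/
theorem nonneg_square_network_solution_dim_three :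
    ∃ (lam : ℝ) (A B C D : Fin 2 → Matrix (Fin 3) (Fin 3) ℝ),
      0 < lam ∧
      (∀ i : Fin 2, ∀ x y : Fin 3, 0 ≤ A i x y) ∧
      (∀ i : Fin 2, ∀ x y : Fin 3, 0 ≤ B i x y) ∧
      (∀ i : Fin 2, ∀ x y : Fin 3, 0 ≤ C i x y) ∧
      (∀ i : Fin 2, ∀ x y : Fin 3, 0 ≤ D i x y) ∧
      (∀ i j k l : Fin 2,
        (A i * B j * C k * D l).trace =
          lam * (if i = k then 1 else 0) * (if j = l then 1 else 0)) := by
  refine ⟨1,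
    ![!![0, 0, 0; 0, 1, 0; 0, 0, 1], !![0, 1, 0; 0, 0, 0; 0, 0, 0]],
    ![!![0, 0, 0; 1, 0, 0; 0, 0, 1], !![0, 0, 0; 0, 0, 1; 0, 0, 0]],
    ![!![0, 0, 0; 0, 0, 0; 1, 0, 0], !![0, 1, 0; 0, 0, 0; 0, 0, 1]],
    ![!![0, 0, 1; 1, 0, 0; 0, 0, 0], !![0, 1, 0; 0, 0, 0; 1, 0, 0]],
    one_pos, ?_, ?_, ?_, ?_, ?_⟩
  iterate 4
    intro i x y
    fin_cases i <;> fin_cases x <;> fin_cases y <;> simp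
  intro i j k l
  fin_cases i <;> fin_cases j <;> fin_cases k <;> fin_cases l <;>
    simp [Matrix.trace, Fin.sum_univ_three]
end
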